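/- arXiv:1410.1698 — 2 statements merged into one kernel-verified Lean document; each statement's English description precedes it below -/
import Mathlib

section
/- Let k be a field, let Γ ⊂ ℝ² be a two-dimensional lattice polygon, and set N = #(Γ ∩ ℤ²). Then for every integer d ≥ 0, the k-vector space I_d(Γ) of homogeneous degree-d elements of the toric ideal I(Γ) satisfies dim_k I_d(Γ) = C(N+d−1, d) − #(dΓ ∩ ℤ²), where C(·,·) denotes the binomial coefficient and dΓ = {d·x : x ∈ Γ}. -/
open Pointwise

noncomputable section

def toR (p : ℤ × ℤ) : ℝ × ℝ := ((p.1 : ℝ), (p.2 : ℝ))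

def IsLatticePolygon (P : Set (ℝ × ℝ)) : Prop :=
  ∃ S : Finset (ℤ × ℤ), P = convexHull ℝ (toR '' ↑S)

def latticePts (A : Set (ℝ × ℝ)) : Set (ℤ × ℤ) := {p | toR p ∈ A}

def interiorHull (P : Set (ℝ × ℝ)) : Set (ℝ × ℝ) :=
  convexHull ℝ (toR '' latticePts (interior P))

abbrev LatPt (Γ : Set (ℝ × ℝ)) := {p : ℤ × ℤ // toR p ∈ Γ}

def chi (k : Type*) [Field k] (Γ : Set (ℝ × ℝ)) :
    MvPolynomial (LatPt Γ) k →ₐ[k] AddMonoidAlgebra k (ℤ × ℤ × ℕ) :=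
  MvPolynomial.aeval fun p =>
    AddMonoidAlgebra.single ((p : ℤ × ℤ).1, (p : ℤ × ℤ).2, (1 : ℕ)) (1 : k)

def toricIdeal (k : Type*) [Field k] (Γ : Set (ℝ × ℝ)) :
    Ideal (MvPolynomial (LatPt Γ) k) := RingHom.ker (chi k Γ)

def toricIdealDeg (k : Type*) [Field k] (Γ : Set (ℝ × ℝ)) (d : ℕ) :
    Submodule k (MvPolynomial (LatPt Γ) k) :=
  Submodule.restrictScalars k (toricIdeal k Γ) ⊓ MvPolynomial.homogeneousSubmodule (LatPt Γ) k d

@[simp] lemma toR_add (p q : ℤ × ℤ) : toR (p + q) = toR p + toR q := by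
  simp [toR]

@[simp] lemma toR_sub (p q : ℤ × ℤ) : toR (p - q) = toR p - toR q := by
  simp [toR]

@[simp] lemma toR_zero : toR 0 = 0 := by
  simp [toR]

lemma toR_injective : Function.Injective toR := fun p q h => by
  simpa [toR, Prod.ext_iff] using h

/-- Twice the signed area of the triangle with vertices `a`, `b`, `c`. -/
def triangleDet (a b c : ℤ × ℤ) : ℤ :=
  (b.1 - a.1) * (c.2 - a.2) - (b.2 - a.2) * (c.1 - a.1)

lemma triangleDet_rotate (a b c : ℤ × ℤ) : triangleDet b c a = triangleDet a b c := by
  unfold triangleDet; ring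

lemma Convex.triple_mem {E : Type*} [AddCommGroup E] [Module ℝ E] {s : Set E} (hs : Convex ℝ s)
    {a b c : E} (ha : a ∈ s) (hb : b ∈ s) (hc : c ∈ s) {α β γ : ℝ} (hα : 0 ≤ α) (hβ : 0 ≤ β)
    (hγ : 0 ≤ γ) (h : α + β + γ = 1) : α • a + β • b + γ • c ∈ s := by
  have := hs.sum_mem (t := Finset.univ) (w := ![α, β, γ]) (z := ![a, b, c])
    (by simp [Fin.forall_fin_succ, hα, hβ, hγ]) (by simpa [Fin.sum_univ_three] using h)
    (by simp [Fin.forall_fin_succ, ha, hb, hc])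
  simpa [Fin.sum_univ_three] using this

/-- A lattice point in the second dilate of a nondegenerate lattice triangle contained in a
convex set `Γ` is a sum of two lattice points of `Γ`. -/
theorem exists_sub_mem_of_mem_two_smul_triangle {Γ : Set (ℝ × ℝ)} (hΓ : Convex ℝ Γ) (p : ℤ × ℤ) :
    ∀ (n : ℕ) (a b c : ℤ × ℤ) (α β γ : ℝ), (triangleDet a b c).natAbs = n →
      triangleDet a b c ≠ 0 → toR a ∈ Γ → toR b ∈ Γ → toR c ∈ Γ → 0 ≤ α → 0 ≤ β → 0 ≤ γ →
      α + β + γ = 2 → toR p = α • toR a + β • toR b + γ • toR c →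
      ∃ q, toR q ∈ Γ ∧ toR (p - q) ∈ Γ := by
  intro n
  induction n using Nat.strong_induction_on with
  | _ n ih =>
  have large : ∀ (a b c : ℤ × ℤ) (α β γ : ℝ), toR a ∈ Γ → toR b ∈ Γ → toR c ∈ Γ →
      1 ≤ α → 0 ≤ β → 0 ≤ γ → α + β + γ = 2 →
      toR p = α • toR a + β • toR b + γ • toR c → ∃ q, toR q ∈ Γ ∧ toR (p - q) ∈ Γ := by
    intro a b c α β γ ha hb hc hα hβ hγ hsum hp
    refine ⟨a, ha, ?_⟩
    have : toR (p - a) = (α - 1) • toR a + β • toR b + γ • toR c := by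
      rw [toR_sub, hp]; module
    rw [this]
    exact hΓ.triple_mem ha hb hc (by linarith) hβ hγ (by linarith)
  have small : ∀ (a b c : ℤ × ℤ) (α β γ : ℝ), (triangleDet a b c).natAbs = n →
      triangleDet a b c ≠ 0 → toR a ∈ Γ → toR b ∈ Γ → toR c ∈ Γ →
      α < 1 → β < 1 → γ < 1 → α ≤ β → α ≤ γ →
      α + β + γ = 2 → toR p = α • toR a + β • toR b + γ • toR c →
      ∃ q, toR q ∈ Γ ∧ toR (p - q) ∈ Γ := by
    intro a b c α β γ hn hdet ha hb hc hα hβ hγ hαβ hαγ hsum hp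
    have hα0 : 0 < α := by linarith
    have hα' : 0 < 1 - α := by linarith
    have hq : toR (a + b + c - p) = (1 - α) • toR a + (1 - β) • toR b + (1 - γ) • toR c := by
      rw [toR_sub, toR_add, toR_add, hp]; module
    have hqΓ : toR (a + b + c - p) ∈ Γ := by
      rw [hq]
      exact hΓ.triple_mem ha hb hc hα'.le (by linarith) (by linarith) (by linarith)
    have hdet' : (triangleDet (a + b + c - p) b c : ℝ) = (1 - α) * triangleDet a b c := by
      have h1 := congrArg Prod.fst hp
      have h2 := congrArg Prod.snd hp
      simp only [toR, Prod.fst_add, Prod.snd_add, Prod.smul_fst, Prod.smul_snd, smul_eq_mul]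
        at h1 h2
      have hγ' : γ = 2 - α - β := by linarith
      subst hγ'
      simp only [triangleDet, Prod.fst_add, Prod.snd_add, Prod.fst_sub, Prod.snd_sub]
      push_cast
      rw [h1, h2]
      ring
    have hdetR : (triangleDet a b c : ℝ) ≠ 0 := by exact_mod_cast hdet
    refine ih (triangleDet (a + b + c - p) b c).natAbs ?_ (a + b + c - p) b c
      (α / (1 - α)) (β - α * (1 - β) / (1 - α)) (γ - α * (1 - γ) / (1 - α)) rfl ?_ hqΓ hb hc
      (by positivity) ?_ ?_ ?_ ?_
    · rw [← hn]
      zify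
      have : |(triangleDet (a + b + c - p) b c : ℝ)| < |(triangleDet a b c : ℝ)| := by
        rw [hdet', abs_mul, abs_of_pos hα']
        have := abs_pos.2 hdetR
        nlinarith
      exact_mod_cast this
    · have : (triangleDet (a + b + c - p) b c : ℝ) ≠ 0 := by
        rw [hdet']
        exact mul_ne_zero hα'.ne' hdetR
      exact_mod_cast this
    · rw [sub_nonneg, div_le_iff₀ hα']
      nlinarith
    · rw [sub_nonneg, div_le_iff₀ hα']
      nlinarith
    · have hγ' : γ = 2 - α - β := by linarith
      subst hγ'
      field_simp
      ring
    · rw [hq, hp]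
      match_scalars <;> field_simp <;> ring
  intro a b c α β γ hn hdet ha hb hc hα hβ hγ hsum hp
  have hpb : toR p = β • toR b + γ • toR c + α • toR a := by rw [hp]; module
  have hpc : toR p = γ • toR c + α • toR a + β • toR b := by rw [hp]; module
  have hb' := triangleDet_rotate a b c
  have hc' := triangleDet_rotate b c a
  by_cases h1 : 1 ≤ α
  · exact large a b c α β γ ha hb hc h1 hβ hγ hsum hp
  by_cases h2 : 1 ≤ β
  · exact large b c a β γ α hb hc ha h2 hγ hα (by linarith) hpb
  by_cases h3 : 1 ≤ γ
  · exact large c a b γ α β hc ha hb h3 hα hβ (by linarith) hpc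
  push Not at h1 h2 h3
  rcases le_total α β with hab | hab <;> rcases le_total β γ with hbc | hbc <;>
    rcases le_total α γ with hac | hac
  all_goals first
    | exact small a b c α β γ hn hdet ha hb hc h1 h2 h3 (by linarith) (by linarith) hsum hp
    | exact small b c a β γ α (by rw [hb', hn]) (by rwa [hb']) hb hc ha h2 h3 h1
        (by linarith) (by linarith) (by linarith) hpb
    | exact small c a b γ α β (by rw [hc', hb', hn]) (by rwa [hc', hb']) hc ha hb h3 h1 h2
        (by linarith) (by linarith) (by linarith) hpc

lemma triangleDet_ne_zero_of_affineIndependent {a b c : ℤ × ℤ}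
    (h : AffineIndependent ℝ ![toR a, toR b, toR c]) : triangleDet a b c ≠ 0 := by
  intro hdet
  have key : ∀ s t : ℝ, s * (b.1 - a.1) + t * (c.1 - a.1) = 0 →
      s * (b.2 - a.2) + t * (c.2 - a.2) = 0 → s = 0 ∧ t = 0 := by
    intro s t h1 h2
    have := affineIndependent_iff.1 h Finset.univ ![-(s + t), s, t]
      (by simp [Fin.sum_univ_three]) (by
        simp only [Fin.sum_univ_three, toR, Matrix.cons_val_zero, Matrix.cons_val_one,
          Matrix.cons_val, Prod.ext_iff, Prod.smul_mk, Prod.mk_add_mk, smul_eq_mul]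
        constructor <;> simp <;> linarith)
    exact ⟨this 1 (Finset.mem_univ _), this 2 (Finset.mem_univ _)⟩
  have hdetR : ((b.1 : ℝ) - a.1) * (c.2 - a.2) - (b.2 - a.2) * (c.1 - a.1) = 0 := by
    exact_mod_cast hdet
  obtain ⟨h1, h2⟩ := key (c.1 - a.1) (-(b.1 - a.1)) (by ring) (by linarith)
  obtain ⟨h3, h4⟩ := key (c.2 - a.2) (-(b.2 - a.2)) (by linarith) (by ring)
  exact one_ne_zero (key 1 1 (by linarith) (by linarith)).1

/-- A lattice point of `(d + 1)Γ` with `d ≥ 1` is the sum of a lattice point of the lattice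
polygon `Γ` and a lattice point of `dΓ`. -/
theorem IsLatticePolygon.exists_sub_mem_smul {Γ : Set (ℝ × ℝ)} (hΓ : IsLatticePolygon Γ) {d : ℕ}
    (hd : 0 < d) {p : ℤ × ℤ} (hp : toR p ∈ ((d + 1 : ℕ) : ℝ) • Γ) :
    ∃ q, toR q ∈ Γ ∧ toR (p - q) ∈ (d : ℝ) • Γ := by
  classical
  obtain ⟨S, rfl⟩ := hΓ
  have hconv := convex_convexHull ℝ (toR '' (S : Set (ℤ × ℤ)))
  obtain ⟨x, hx, hxp⟩ := hp
  obtain ⟨ι, _, z, w, hz, hind, hw, hw1, hwx⟩ := eq_pos_convex_span_of_mem_convexHull hx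
  have hzs : ∀ i, ∃ s ∈ S, toR s = z i := fun i => hz ⟨i, rfl⟩
  choose s hsS hs using hzs
  have hsΓ : ∀ i, toR (s i) ∈ convexHull ℝ (toR '' (S : Set (ℤ × ℤ))) := fun i =>
    subset_convexHull _ _ ⟨s i, hsS i, rfl⟩
  have hpx : toR p = ∑ i, (((d + 1 : ℕ) : ℝ) * w i) • toR (s i) := by
    rw [← hxp, ← hwx]
    simp [Finset.smul_sum, mul_smul, hs]
  have hd' : (0 : ℝ) < d := by exact_mod_cast hd
  by_cases hlarge : ∃ i, 1 ≤ ((d + 1 : ℕ) : ℝ) * w i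
  · obtain ⟨i, hi⟩ := hlarge
    refine ⟨s i, hsΓ i, ?_⟩
    rw [Set.mem_smul_set]
    refine ⟨∑ j, ((((d + 1 : ℕ) : ℝ) * w j - if j = i then 1 else 0) / d) • toR (s j),
      hconv.sum_mem ?_ ?_ fun j _ => hsΓ j, ?_⟩
    · intro j _
      refine div_nonneg ?_ hd'.le
      split_ifs with hji
      · subst hji; linarith
      · have := hw j
        rw [sub_zero]; positivity
    · rw [← Finset.sum_div, Finset.sum_sub_distrib, ← Finset.mul_sum, hw1]
      simp [hd.ne']
    · rw [toR_sub, hpx, Finset.smul_sum]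
      simp only [smul_smul, mul_div_cancel₀ _ hd'.ne', sub_smul, Finset.sum_sub_distrib]
      simp
  · push Not at hlarge
    have hne : (Finset.univ : Finset ι).Nonempty := by
      by_contra h
      rw [Finset.not_nonempty_iff_eq_empty] at h
      simp [h] at hw1
    have hlt : ((d + 1 : ℕ) : ℝ) < Fintype.card ι := by
      calc ((d + 1 : ℕ) : ℝ) = ∑ i, ((d + 1 : ℕ) : ℝ) * w i := by
            rw [← Finset.mul_sum, hw1, mul_one]
        _ < ∑ _i : ι, (1 : ℝ) := Finset.sum_lt_sum_of_nonempty hne fun i _ => hlarge i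
        _ = Fintype.card ι := by simp
    have hcard : Fintype.card ι ≤ 3 := by
      have h1 := hind.card_le_finrank_succ
      have h2 := Submodule.finrank_le (vectorSpan ℝ (Set.range z))
      have h3 : Module.finrank ℝ (ℝ × ℝ) = 2 := by simp
      omega
    have hlt' : d + 1 < Fintype.card ι := by exact_mod_cast hlt
    obtain rfl : d = 1 := by omega
    let e : Fin 3 ≃ ι := (Fintype.equivFinOfCardEq (by omega)).symm
    have hsum : ∀ f : ι → ℝ, ∑ i, f i = f (e 0) + f (e 1) + f (e 2) := fun f => by
      rw [← e.sum_comp, Fin.sum_univ_three]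
    have hdet : triangleDet (s (e 0)) (s (e 1)) (s (e 2)) ≠ 0 := by
      apply triangleDet_ne_zero_of_affineIndependent
      have : ![toR (s (e 0)), toR (s (e 1)), toR (s (e 2))] = z ∘ e := by
        funext i
        fin_cases i <;> simp [hs]
      rw [this]
      exact hind.comp_embedding e.toEmbedding
    have hpos : ∀ i, 0 ≤ ((1 + 1 : ℕ) : ℝ) * w i := fun i => by
      have := hw i
      positivity
    rw [Nat.cast_one, one_smul ℝ]
    refine exists_sub_mem_of_mem_two_smul_triangle hconv p _ _ _ _ _ _ _ rfl hdet (hsΓ _) (hsΓ _)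
      (hsΓ _) (hpos (e 0)) (hpos (e 1)) (hpos (e 2)) ?_ ?_
    · rw [← mul_add, ← mul_add, ← hsum, hw1]
      norm_num
    · rw [hpx, ← e.sum_comp, Fin.sum_univ_three]

/-- Lattice polygons are normal: the lattice points of `dΓ` are exactly the sums of `d` lattice
points of `Γ`. -/
theorem IsLatticePolygon.mem_latticePts_smul_iff {Γ : Set (ℝ × ℝ)} (hΓ : IsLatticePolygon Γ)
    (hne : Γ.Nonempty) (d : ℕ) (p : ℤ × ℤ) :
    p ∈ latticePts ((d : ℝ) • Γ) ↔
      ∃ m : Multiset (LatPt Γ), m.card = d ∧ (m.map Subtype.val).sum = p := by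
  have hconv : Convex ℝ Γ := by
    obtain ⟨S, rfl⟩ := hΓ
    exact convex_convexHull _ _
  change toR p ∈ (d : ℝ) • Γ ↔ _
  induction d generalizing p with
  | zero =>
    rw [Nat.cast_zero, Set.zero_smul_set hne]
    simp only [Set.mem_zero, Multiset.card_eq_zero, exists_eq_left, Multiset.map_zero,
      Multiset.sum_zero]
    rw [← toR_zero, toR_injective.eq_iff, eq_comm]
  | succ d ih =>
    constructor
    · intro hp
      obtain ⟨q, hq, hpq⟩ : ∃ q, toR q ∈ Γ ∧ toR (p - q) ∈ (d : ℝ) • Γ := by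
        rcases d.eq_zero_or_pos with rfl | hd
        · refine ⟨p, by simpa using hp, ?_⟩
          simp [Set.zero_smul_set hne]
        · exact hΓ.exists_sub_mem_smul hd hp
      obtain ⟨m, hm, hmp⟩ := (ih _).1 hpq
      exact ⟨⟨q, hq⟩ ::ₘ m, by simp [hm], by simp [hmp]⟩
    · rintro ⟨m, hm, rfl⟩
      obtain ⟨q, m, rfl⟩ := Multiset.card_pos_iff_exists_mem.1 (by omega : 0 < m.card) |>.imp
        fun q hq => Multiset.exists_cons_of_mem hq
      have hm' : toR (m.map Subtype.val).sum ∈ (d : ℝ) • Γ :=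
        (ih _).2 ⟨m, by simpa using hm, rfl⟩
      rw [Multiset.map_cons, Multiset.sum_cons, toR_add, Nat.cast_add, Nat.cast_one, add_comm (d : ℝ),
        hconv.add_smul zero_le_one d.cast_nonneg, one_smul]
      exact Set.add_mem_add q.2 hm'

lemma IsLatticePolygon.finite_latPt {Γ : Set (ℝ × ℝ)} (hΓ : IsLatticePolygon Γ) :
    Finite (LatPt Γ) := by
  have hemb : Topology.IsClosedEmbedding toR :=
    Int.isClosedEmbedding_coe_real.prodMap Int.isClosedEmbedding_coe_real
  have hcomp : IsCompact Γ := by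
    obtain ⟨S, rfl⟩ := hΓ
    exact (S.finite_toSet.image toR).isCompact_convexHull ℝ
  exact (hemb.isCompact_preimage hcomp).finite_of_discrete

lemma chi_monomial_one (k : Type*) [Field k] (Γ : Set (ℝ × ℝ)) (m : Multiset (LatPt Γ)) :
    chi k Γ (MvPolynomial.monomial (Multiset.toFinsupp m) 1) =
      AddMonoidAlgebra.single
        ((m.map Subtype.val).sum.1, (m.map Subtype.val).sum.2, m.card) 1 := by
  classical
  induction m using Multiset.induction_on with
  | empty => exact map_one (chi k Γ)
  | cons q m ih =>
    have : MvPolynomial.monomial (Multiset.toFinsupp (q ::ₘ m)) (1 : k) =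
        MvPolynomial.X q * MvPolynomial.monomial (Multiset.toFinsupp m) 1 := by
      rw [← Multiset.singleton_add, map_add, Multiset.toFinsupp_singleton, MvPolynomial.X,
        MvPolynomial.monomial_mul, one_mul]
    rw [this, map_mul, ih, chi, MvPolynomial.aeval_X, AddMonoidAlgebra.single_mul_single]
    simp [add_comm]

lemma AddMonoidAlgebra.finrank_supported (k : Type*) [Field k] {M : Type*} (s : Set M) :
    Module.finrank k (AddMonoidAlgebra.supported k k s) = Nat.card s := by
  exact Module.finrank_eq_nat_card_basis
    (Module.Basis.ofRepr (AddMonoidAlgebra.supportedEquivFinsupp (R := k) (S := k) s))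

lemma MvPolynomial.finrank_homogeneousSubmodule (k : Type*) [Field k] (σ : Type*) (d : ℕ) :
    Module.finrank k (MvPolynomial.homogeneousSubmodule σ k d) =
      (Nat.card σ + d - 1).choose d := by
  classical
  rw [MvPolynomial.homogeneousSubmodule_eq_finsupp_supported,
    AddMonoidAlgebra.finrank_supported, ← Sym.natCard_sym_eq_choose]
  exact Nat.card_congr (Sym.equivNatSum σ d).symm

/-- The image of the degree `d` polynomials under `chi` is spanned by the monomials
`x ^ i * y ^ j * t ^ d` with `(i, j)` a lattice point of `dΓ`. -/
theorem map_chi_homogeneousSubmodule (k : Type*) [Field k] {Γ : Set (ℝ × ℝ)}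
    (hΓ : IsLatticePolygon Γ) (hne : Γ.Nonempty) (d : ℕ) :
    (MvPolynomial.homogeneousSubmodule (LatPt Γ) k d).map (chi k Γ).toLinearMap =
      AddMonoidAlgebra.supported k k
        ((fun p : ℤ × ℤ => (p.1, p.2, d)) '' latticePts ((d : ℝ) • Γ)) := by
  classical
  rw [MvPolynomial.homogeneousSubmodule_eq_finsupp_supported,
    AddMonoidAlgebra.supported_eq_span_single, AddMonoidAlgebra.supported_eq_span_single,
    Submodule.map_span]
  congr 1
  ext f
  simp only [Set.mem_image, hΓ.mem_latticePts_smul_iff hne]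
  constructor
  · rintro ⟨_, ⟨v, hv, rfl⟩, rfl⟩
    obtain ⟨m, rfl⟩ := (Multiset.toFinsupp (α := LatPt Γ)).surjective v
    have hm : m.card = d := by
      rw [← hv, ← Multiset.toFinsupp_sum_eq]; rfl
    exact ⟨_, ⟨_, ⟨m, hm, rfl⟩, rfl⟩, by rw [← hm]; exact (chi_monomial_one k Γ m).symm⟩
  · rintro ⟨_, ⟨_, ⟨m, hm, rfl⟩, rfl⟩, rfl⟩
    refine ⟨_, ⟨Multiset.toFinsupp m, ?_, rfl⟩, by rw [← hm]; exact chi_monomial_one k Γ m⟩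
    rw [Set.mem_ofPred_eq, ← hm, ← Multiset.toFinsupp_sum_eq]; rfl

theorem stmt0 (k : Type*) [Field k] (Γ : Set (ℝ × ℝ))
    (hpoly : IsLatticePolygon Γ) (hdim : ¬ Collinear ℝ Γ) (d : ℕ) :
    (Module.finrank k (toricIdealDeg k Γ d) : ℤ)
      = (((latticePts Γ).ncard + d - 1).choose d : ℤ)
        - ((latticePts ((d : ℝ) • Γ)).ncard : ℤ) := by
  have hne : Γ.Nonempty := by
    rw [Set.nonempty_iff_ne_empty]
    rintro rfl
    exact hdim (collinear_empty ℝ _)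
  have := hpoly.finite_latPt
  set V := MvPolynomial.homogeneousSubmodule (LatPt Γ) k d with hV
  have : FiniteDimensional k V :=
    Module.Finite.iff_fg.2 (MvPolynomial.homogeneousSubmodule_fg (LatPt Γ) k d)
  have hrank := ((chi k Γ).toLinearMap.domRestrict V).finrank_range_add_finrank_ker
  have hker : Module.finrank k (LinearMap.ker ((chi k Γ).toLinearMap.domRestrict V)) =
      Module.finrank k (toricIdealDeg k Γ d) := by
    have h : toricIdealDeg k Γ d =
        (LinearMap.ker ((chi k Γ).toLinearMap.domRestrict V)).map V.subtype := by
      ext f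
      simp [toricIdealDeg, toricIdeal, hV, and_comm]
    rw [h]
    exact (Submodule.finrank_map_subtype_eq V _).symm
  have hrange : Module.finrank k (LinearMap.range ((chi k Γ).toLinearMap.domRestrict V)) =
      (latticePts ((d : ℝ) • Γ)).ncard := by
    rw [LinearMap.range_domRestrict, map_chi_homogeneousSubmodule k hpoly hne,
      AddMonoidAlgebra.finrank_supported, Nat.card_coe_set_eq]
    refine Set.ncard_image_of_injective _ fun p q h => ?_
    simpa [Prod.ext_iff] using h
  have hN : Nat.card (LatPt Γ) = (latticePts Γ).ncard := rfl
  rw [hker, hrange, MvPolynomial.finrank_homogeneousSubmodule, hN] at hrank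
  omega
end
end

section
/- Let k be an algebraically closed field, let Γ ⊂ ℝ² be a two-dimensional lattice polygon, and set N = #(Γ ∩ ℤ²). Then the toric ideal I(Γ) is generated, as an ideal of k[X_p : p ∈ Γ ∩ ℤ²], by its homogeneous elements of degrees 2 and 3, and the space of quadrics it contains has dimension dim_k I₂(Γ) = C(N+1, 2) − #(2Γ ∩ ℤ²). -/
open Pointwise

noncomputable section

namespace LatticeRelations

/-- The determinant of the rows `(s, d)`, `(q, 1)`, `(r, 1)`. -/
def hdet (d : ℤ) (s q r : ℤ × ℤ) : ℤ :=
  s.1 * (q.2 - r.2) - s.2 * (q.1 - r.1) + d * (q.1 * r.2 - q.2 * r.1)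

/-- A parallelogram of area greater than one contains a lattice point that is not a vertex, and
its lower half does as well. -/
lemma exists_lattice_point_half_parallelogram (u v : ℤ × ℤ) (hD : 1 < u.1 * v.2 - u.2 * v.1) :
    ∃ x : ℤ × ℤ,
      0 ≤ x.1 * v.2 - x.2 * v.1 ∧ x.1 * v.2 - x.2 * v.1 < u.1 * v.2 - u.2 * v.1 ∧
      0 ≤ u.1 * x.2 - u.2 * x.1 ∧ u.1 * x.2 - u.2 * x.1 < u.1 * v.2 - u.2 * v.1 ∧
      0 < (x.1 * v.2 - x.2 * v.1) + (u.1 * x.2 - u.2 * x.1) ∧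
      (x.1 * v.2 - x.2 * v.1) + (u.1 * x.2 - u.2 * x.1) ≤ u.1 * v.2 - u.2 * v.1 := by
  obtain ⟨u1, u2⟩ := u
  obtain ⟨v1, v2⟩ := v
  simp only at *
  set D := u1 * v2 - u2 * v1 with hDdef
  have key : ∃ w : ℤ × ℤ, ¬ (D ∣ w.1 * v2 - w.2 * v1 ∧ D ∣ u1 * w.2 - u2 * w.1) := by
    by_contra! h
    obtain ⟨⟨a, ha⟩, ⟨b, hb⟩⟩ := h (1, 0)
    obtain ⟨⟨c, hc⟩, ⟨e, he⟩⟩ := h (0, 1)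
    simp only at ha hb hc he
    have h1 : D * 1 = D * (D * (e * a - b * c)) := by
      have e1 : v2 = D * a := by linarith
      have e2 : u2 = - (D * b) := by linarith
      have e3 : v1 = - (D * c) := by linarith
      have e4 : u1 = D * e := by linarith
      calc D * 1 = u1 * v2 - u2 * v1 := by rw [hDdef]; ring
        _ = D * (D * (e * a - b * c)) := by rw [e1, e2, e3, e4]; ring
    have h2 := mul_left_cancel₀ (by omega : D ≠ 0) h1
    have := Int.eq_one_of_mul_eq_one_right (by omega : 0 ≤ D) h2.symm
    omega
  obtain ⟨w, hw⟩ := key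
  set A := w.1 * v2 - w.2 * v1 with hA
  set B := u1 * w.2 - u2 * w.1 with hB
  have hA0 := Int.emod_nonneg A (by omega : D ≠ 0)
  have hB0 := Int.emod_nonneg B (by omega : D ≠ 0)
  have hA1 := Int.emod_lt_of_pos A (by omega : 0 < D)
  have hB1 := Int.emod_lt_of_pos B (by omega : 0 < D)
  have hpos : 0 < A % D + B % D := by
    by_contra h
    exact hw ⟨Int.dvd_of_emod_eq_zero (by omega), Int.dvd_of_emod_eq_zero (by omega)⟩
  have eA : A % D = A - D * (A / D) := by have := Int.emod_add_mul_ediv A D; linarith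
  have eB : B % D = B - D * (B / D) := by have := Int.emod_add_mul_ediv B D; linarith
  set x : ℤ × ℤ := (w.1 - A / D * u1 - B / D * v1, w.2 - A / D * u2 - B / D * v2) with hx
  have e1 : x.1 * v2 - x.2 * v1 = A % D := by rw [eA, hx, hA, hDdef]; ring
  have e2 : u1 * x.2 - u2 * x.1 = B % D := by rw [eB, hx, hB, hDdef]; ring
  by_cases hle : A % D + B % D ≤ D
  · exact ⟨x, by rw [e1, e2]; exact ⟨hA0, hA1, hB0, hB1, hpos, hle⟩⟩
  · refine ⟨(u1 + v1 - x.1, u2 + v2 - x.2), ?_⟩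
    have e3 : (u1 + v1 - x.1) * v2 - (u2 + v2 - x.2) * v1 = D - A % D := by
      rw [← e1, hDdef]; ring
    have e4 : u1 * (u2 + v2 - x.2) - u2 * (u1 + v1 - x.1) = D - B % D := by
      rw [← e2, hDdef]; ring
    simp only [e3, e4]
    omega

/-- A lattice triangle of normalized area greater than one contains a lattice point that is not a
vertex. -/
lemma exists_lattice_point_triangle (p q r : ℤ × ℤ) (hD : 1 < hdet 1 p q r) :
    ∃ t : ℤ × ℤ,
      0 ≤ hdet 1 t q r ∧ hdet 1 t q r < hdet 1 p q r ∧
      0 ≤ hdet 1 t r p ∧ hdet 1 t r p < hdet 1 p q r ∧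
      0 ≤ hdet 1 t p q ∧ hdet 1 t p q < hdet 1 p q r := by
  have e0 : (q - p).1 * (r - p).2 - (q - p).2 * (r - p).1 = hdet 1 p q r := by
    simp only [hdet, Prod.fst_sub, Prod.snd_sub]; ring
  obtain ⟨x, h1, h2, h3, h4, h5, h6⟩ :=
    exists_lattice_point_half_parallelogram (q - p) (r - p) (by rwa [e0])
  rw [e0] at h2 h4 h6
  have e1 : hdet 1 (p + x) r p = x.1 * (r - p).2 - x.2 * (r - p).1 := by
    simp only [hdet, Prod.fst_sub, Prod.snd_sub, Prod.fst_add, Prod.snd_add]; ring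
  have e2 : hdet 1 (p + x) p q = (q - p).1 * x.2 - (q - p).2 * x.1 := by
    simp only [hdet, Prod.fst_sub, Prod.snd_sub, Prod.fst_add, Prod.snd_add]; ring
  have e3 : hdet 1 (p + x) q r + hdet 1 (p + x) r p + hdet 1 (p + x) p q = hdet 1 p q r := by
    simp only [hdet]; ring
  refine ⟨p + x, ?_⟩
  rw [← e1] at h1 h2 h5 h6
  rw [← e2] at h3 h4 h5 h6
  omega

section Combinatorics

variable {σ : Type*} (pt : σ → ℤ × ℤ)

/-- The exponent of the image of a monomial: the sum of its points, and its degree. -/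
noncomputable def latSum : (σ →₀ ℕ) →+ ℤ × ℤ × ℕ :=
  (Finsupp.linearCombination ℕ fun p => ((pt p).1, (pt p).2, (1 : ℕ))).toAddMonoidHom

/-- The squared norm of a lattice point. -/
def normSq (p : ℤ × ℤ) : ℤ := p.1 ^ 2 + p.2 ^ 2

/-- The sum of the squared norms of the points of a monomial. -/
noncomputable def sqWeight : (σ →₀ ℕ) →+ ℤ :=
  (Finsupp.linearCombination ℕ fun p => normSq (pt p)).toAddMonoidHom

@[simp] lemma latSum_single (p : σ) (n : ℕ) :
    latSum pt (Finsupp.single p n) = (n * (pt p).1, n * (pt p).2, n) := by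
  simp [latSum]

@[simp] lemma sqWeight_single (p : σ) (n : ℕ) :
    sqWeight pt (Finsupp.single p n) = n * normSq (pt p) := by
  simp [sqWeight]

/-- Every lattice point of a triangle with vertices in the family is in the family. -/
def LatticeConvex : Prop :=
  ∀ (p q r : σ) (x : ℤ × ℤ) (a b c : ℤ), 0 ≤ a → 0 ≤ b → 0 ≤ c → 0 < a + b + c →
    (a + b + c) * x.1 = a * (pt p).1 + b * (pt q).1 + c * (pt r).1 →
    (a + b + c) * x.2 = a * (pt p).2 + b * (pt q).2 + c * (pt r).2 → ∃ y, pt y = x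

lemma hdet_rotate (p q r : ℤ × ℤ) : hdet 1 q r p = hdet 1 p q r := by
  simp only [hdet]; ring

lemma hdet_add (d : ℤ) (s p q r : ℤ × ℤ) :
    hdet d s q r + hdet d s r p + hdet d s p q = d * hdet 1 p q r := by
  simp only [hdet]; ring

lemma hdet_cramer_fst (d : ℤ) (s p q r : ℤ × ℤ) :
    hdet d s q r * p.1 + hdet d s r p * q.1 + hdet d s p q * r.1 = hdet 1 p q r * s.1 := by
  simp only [hdet]; ring

lemma hdet_cramer_snd (d : ℤ) (s p q r : ℤ × ℤ) :
    hdet d s q r * p.2 + hdet d s r p * q.2 + hdet d s p q * r.2 = hdet 1 p q r * s.2 := by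
  simp only [hdet]; ring

lemma LatticeConvex.exists_of_hdet_nonneg {pt : σ → ℤ × ℤ} (h : LatticeConvex pt) (p q r : σ)
    (t : ℤ × ℤ) (hD : 0 < hdet 1 (pt p) (pt q) (pt r)) (h1 : 0 ≤ hdet 1 t (pt q) (pt r))
    (h2 : 0 ≤ hdet 1 t (pt r) (pt p)) (h3 : 0 ≤ hdet 1 t (pt p) (pt q)) : ∃ y, pt y = t := by
  have e := hdet_add 1 t (pt p) (pt q) (pt r)
  refine h p q r t _ _ _ h1 h2 h3 (by omega) ?_ ?_
  · rw [hdet_cramer_fst, e, one_mul]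
  · rw [hdet_cramer_snd, e, one_mul]

/-- The convexity defect of the squared norm on a triangle. -/
lemma normSq_defect (p q r t : ℤ × ℤ) :
    hdet 1 p q r * (hdet 1 t q r * normSq p + hdet 1 t r p * normSq q + hdet 1 t p q * normSq r -
        hdet 1 p q r * normSq t) =
      hdet 1 t q r * hdet 1 t r p * normSq (p - q) + hdet 1 t q r * hdet 1 t p q * normSq (p - r) +
        hdet 1 t r p * hdet 1 t p q * normSq (q - r) := by
  have e0 := hdet_add 1 t p q r
  have e1 := hdet_cramer_fst 1 t p q r
  have e2 := hdet_cramer_snd 1 t p q r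
  generalize hdet 1 t q r = a at *
  generalize hdet 1 t r p = b at *
  generalize hdet 1 t p q = c at *
  generalize hdet 1 p q r = D at *
  have e3 : D * (D * normSq t) = (D * t.1) ^ 2 + (D * t.2) ^ 2 := by simp only [normSq]; ring
  rw [mul_sub, e3, ← e1, ← e2]
  simp only [normSq, Prod.fst_sub, Prod.snd_sub]
  rw [one_mul] at e0
  rw [← e0]
  ring

/-- Convexity of the squared norm on a triangle. -/
lemma normSq_le (p q r t : ℤ × ℤ) (hD : 0 < hdet 1 p q r) (h1 : 0 ≤ hdet 1 t q r)
    (h2 : 0 ≤ hdet 1 t r p) (h3 : 0 ≤ hdet 1 t p q) :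
    hdet 1 p q r * normSq t ≤
      hdet 1 t q r * normSq p + hdet 1 t r p * normSq q + hdet 1 t p q * normSq r := by
  rw [← sub_nonneg]
  refine nonneg_of_mul_nonneg_right ?_ hD
  rw [normSq_defect]
  simp only [normSq]
  positivity

lemma normSq_pos {p q : ℤ × ℤ} (h : p ≠ q) : 0 < normSq (p - q) := by
  simp only [normSq, Prod.fst_sub, Prod.snd_sub]
  by_contra! h'
  refine h (Prod.ext ?_ ?_) <;> nlinarith [sq_nonneg (p.1 - q.1), sq_nonneg (p.2 - q.2)]

/-- Strict convexity of the squared norm on a triangle. -/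
lemma normSq_lt (p q r t : ℤ × ℤ) (hD : 0 < hdet 1 p q r) (h1 : 0 ≤ hdet 1 t q r)
    (h2 : 0 ≤ hdet 1 t r p) (h3 : 0 ≤ hdet 1 t p q) (k1 : hdet 1 t q r < hdet 1 p q r)
    (k2 : hdet 1 t r p < hdet 1 p q r) (k3 : hdet 1 t p q < hdet 1 p q r) :
    hdet 1 p q r * normSq t <
      hdet 1 t q r * normSq p + hdet 1 t r p * normSq q + hdet 1 t p q * normSq r := by
  have n1 : 0 < normSq (p - q) := normSq_pos (by rintro rfl; simp [hdet] at hD; linarith)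
  have n2 : 0 < normSq (p - r) := normSq_pos (by rintro rfl; simp [hdet] at hD; linarith)
  have n3 : 0 < normSq (q - r) := normSq_pos (by rintro rfl; simp [hdet] at hD; linarith)
  have e0 := hdet_add 1 t p q r
  rw [← sub_pos]
  refine pos_of_mul_pos_right ?_ hD.le
  rw [normSq_defect]
  rcases h1.eq_or_lt with h1 | h1
  · have : 0 < hdet 1 t r p := by omega
    have : 0 < hdet 1 t p q := by omega
    simp only [← h1, zero_mul, zero_add]; positivity
  · rcases h2.eq_or_lt with h2 | h2
    · have : 0 < hdet 1 t p q := by omega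
      simp only [← h2, zero_mul, mul_zero, zero_add, add_zero]; positivity
    · positivity

/-- Among three ratios of nonnegative integers, one is the least. -/
lemma exists_min_ratio {a b c α β γ : ℤ} (ha : 0 ≤ a) (hb : 0 ≤ b) (hc : 0 ≤ c) (hα : 0 ≤ α)
    (hβ : 0 ≤ β) (hγ : 0 ≤ γ) (hs : 0 < α + β + γ) :
    (0 < α ∧ a * β ≤ b * α ∧ a * γ ≤ c * α) ∨ (0 < β ∧ b * γ ≤ c * β ∧ b * α ≤ a * β) ∨
      (0 < γ ∧ c * α ≤ a * γ ∧ c * β ≤ b * γ) := by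
  have trans : ∀ {a b c α β γ : ℤ}, 0 ≤ α → 0 < β → 0 ≤ γ → a * β ≤ b * α → b * γ ≤ c * β →
      a * γ ≤ c * α := by
    intro a b c α β γ hα hβ hγ h1 h2
    refine le_of_mul_le_mul_left ?_ hβ
    nlinarith [mul_le_mul_of_nonneg_left h1 hγ, mul_le_mul_of_nonneg_left h2 hα]
  rcases hα.eq_or_lt with rfl | hα
  · rcases hβ.eq_or_lt with rfl | hβ
    · right; right; simp; exact ⟨by omega, by positivity, by positivity⟩
    · rcases hγ.eq_or_lt with rfl | hγ
      · right; left; simp; exact ⟨hβ, by positivity, by positivity⟩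
      · rcases le_total (b * γ) (c * β) with h | h
        · right; left; simp; exact ⟨hβ, h, by positivity⟩
        · right; right; simp; exact ⟨hγ, by positivity, h⟩
  · rcases hβ.eq_or_lt with rfl | hβ
    · rcases le_total (a * γ) (c * α) with h | h
      · left; simp; exact ⟨hα, by positivity, h⟩
      · rcases hγ.eq_or_lt with rfl | hγ
        · left; simp; exact ⟨hα, by positivity, by positivity⟩
        · right; right; simp; exact ⟨hγ, h, by positivity⟩
    · rcases le_total (a * β) (b * α) with h | h
      · rcases le_total (a * γ) (c * α) with h' | h'
        · exact Or.inl ⟨hα, h, h'⟩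
        · rcases hγ.eq_or_lt with rfl | hγ
          · left; simp; exact ⟨hα, h, by positivity⟩
          · exact Or.inr (Or.inr ⟨hγ, h', trans hγ.le hα hβ.le h' h⟩)
      · rcases le_total (b * γ) (c * β) with h' | h'
        · exact Or.inr (Or.inl ⟨hβ, h', h⟩)
        · rcases hγ.eq_or_lt with rfl | hγ
          · right; left; simp; exact ⟨hβ, by positivity, h⟩
          · exact Or.inr (Or.inr ⟨hγ, trans hγ.le hβ hα.le h' h, h'⟩)

variable {pt} in
/-- Lattice points of the dilate of a lattice triangle are sums of lattice points of the
triangle. -/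
lemma LatticeConvex.exists_latSum_eq (hc : LatticeConvex pt) (s : ℤ × ℤ) (d : ℕ) (p q r : σ)
    (hD : 0 < hdet 1 (pt p) (pt q) (pt r)) (ha : 0 ≤ hdet d s (pt q) (pt r))
    (hb : 0 ≤ hdet d s (pt r) (pt p)) (he : 0 ≤ hdet d s (pt p) (pt q)) :
    ∃ m : σ →₀ ℕ, latSum pt m = (s.1, s.2, d) ∧
      hdet 1 (pt p) (pt q) (pt r) * sqWeight pt m ≤
        hdet d s (pt q) (pt r) * normSq (pt p) + hdet d s (pt r) (pt p) * normSq (pt q) +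
          hdet d s (pt p) (pt q) * normSq (pt r) := by
  induction hn : (hdet 1 (pt p) (pt q) (pt r)).toNat using Nat.strong_induction_on
    generalizing p q r with
  | _ n ih =>
  rcases (show hdet 1 (pt p) (pt q) (pt r) = 1 ∨ 1 < hdet 1 (pt p) (pt q) (pt r) by omega)
    with h1 | h1
  · refine ⟨Finsupp.single p (hdet d s (pt q) (pt r)).toNat +
      Finsupp.single q (hdet d s (pt r) (pt p)).toNat +
      Finsupp.single r (hdet d s (pt p) (pt q)).toNat, ?_, ?_⟩
    · have e0 := hdet_add d s (pt p) (pt q) (pt r)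
      have e1 := hdet_cramer_fst d s (pt p) (pt q) (pt r)
      have e2 := hdet_cramer_snd d s (pt p) (pt q) (pt r)
      rw [h1, one_mul] at e1 e2
      rw [h1, mul_one] at e0
      simp only [map_add, latSum_single, Prod.mk_add_mk, Prod.mk.injEq, Int.toNat_of_nonneg ha,
        Int.toNat_of_nonneg hb, Int.toNat_of_nonneg he]
      exact ⟨e1, e2, by omega⟩
    · simp only [map_add, sqWeight_single, Int.toNat_of_nonneg ha, Int.toNat_of_nonneg hb,
        Int.toNat_of_nonneg he, h1, one_mul, le_refl]
  · obtain ⟨t', t1, k1, t2, k2, t3, k3⟩ := exists_lattice_point_triangle _ _ _ h1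
    obtain ⟨t, rfl⟩ := hc.exists_of_hdet_nonneg p q r t' hD t1 t2 t3
    have step : ∀ p q r : σ, 0 < hdet 1 (pt p) (pt q) (pt r) →
        (hdet 1 (pt p) (pt q) (pt r)).toNat = n →
        0 ≤ hdet d s (pt q) (pt r) → 0 ≤ hdet d s (pt r) (pt p) → 0 ≤ hdet d s (pt p) (pt q) →
        0 < hdet 1 (pt t) (pt q) (pt r) → 0 ≤ hdet 1 (pt t) (pt r) (pt p) →
        0 ≤ hdet 1 (pt t) (pt p) (pt q) →
        hdet 1 (pt t) (pt q) (pt r) < hdet 1 (pt p) (pt q) (pt r) →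
        hdet d s (pt q) (pt r) * hdet 1 (pt t) (pt r) (pt p) ≤
          hdet d s (pt r) (pt p) * hdet 1 (pt t) (pt q) (pt r) →
        hdet d s (pt q) (pt r) * hdet 1 (pt t) (pt p) (pt q) ≤
          hdet d s (pt p) (pt q) * hdet 1 (pt t) (pt q) (pt r) →
        ∃ m : σ →₀ ℕ, latSum pt m = (s.1, s.2, d) ∧
          hdet 1 (pt p) (pt q) (pt r) * sqWeight pt m ≤
            hdet d s (pt q) (pt r) * normSq (pt p) + hdet d s (pt r) (pt p) * normSq (pt q) +
              hdet d s (pt p) (pt q) * normSq (pt r) := by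
      intro p q r hD hn ha hb he hα hβ hγ hlt h2 h3
      have p2 : hdet 1 (pt p) (pt q) (pt r) * hdet d s (pt r) (pt t) =
          hdet d s (pt r) (pt p) * hdet 1 (pt t) (pt q) (pt r) -
            hdet d s (pt q) (pt r) * hdet 1 (pt t) (pt r) (pt p) := by
        simp only [hdet]; ring
      have p3 : hdet 1 (pt p) (pt q) (pt r) * hdet d s (pt t) (pt q) =
          hdet d s (pt p) (pt q) * hdet 1 (pt t) (pt q) (pt r) -
            hdet d s (pt q) (pt r) * hdet 1 (pt t) (pt p) (pt q) := by
        simp only [hdet]; ring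
      have cv := normSq_le _ _ _ _ hD hα.le hβ hγ
      obtain ⟨m, hm, hw⟩ := ih _ (by omega) t q r hα ha
        (nonneg_of_mul_nonneg_right (by rw [p2]; omega) hD)
        (nonneg_of_mul_nonneg_right (by rw [p3]; omega) hD) rfl
      refine ⟨m, hm, le_of_mul_le_mul_left ?_ hα⟩
      have hw' := mul_le_mul_of_nonneg_left hw hD.le
      have cv' := mul_le_mul_of_nonneg_left cv ha
      linear_combination hw' + cv' + normSq (pt q) * p2 + normSq (pt r) * p3
    have e0 := hdet_add 1 (pt t) (pt p) (pt q) (pt r)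
    have r1 := hdet_rotate (pt p) (pt q) (pt r)
    have r2 := hdet_rotate (pt q) (pt r) (pt p)
    rcases exists_min_ratio ha hb he t1 t2 t3 (by omega) with ⟨h2, h3, h4⟩ | ⟨h2, h3, h4⟩ |
      ⟨h2, h3, h4⟩
    · exact step p q r hD hn ha hb he h2 t2 t3 k1 h3 h4
    · obtain ⟨m, hm, hw⟩ := step q r p (by omega) (by omega) hb he ha h2 t3 t1 (by omega) h3 h4
      exact ⟨m, hm, by rw [r1] at hw; linarith⟩
    · obtain ⟨m, hm, hw⟩ := step r p q (by omega) (by omega) he ha hb h2 t1 t2 (by omega) h3 h4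
      exact ⟨m, hm, by rw [r2, r1] at hw; linarith⟩

lemma latSum_snd_snd (m : σ →₀ ℕ) : (latSum pt m).2.2 = m.degree := by
  induction m using Finsupp.induction_linear with
  | zero => simp
  | add f g hf hg => simp [hf, hg]
  | single p n => simp

lemma single_add_single_le {m : σ →₀ ℕ} {p q : σ} (hp : p ∈ m.support) (hq : q ∈ m.support)
    (hpq : p ≠ q) : Finsupp.single p 1 + Finsupp.single q 1 ≤ m := by
  classical
  intro x
  rw [Finsupp.mem_support_iff] at hp hq
  simp only [Finsupp.add_apply, Finsupp.single_apply]
  split_ifs with h1 h2 h2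
  · exact absurd (h1.trans h2.symm) hpq
  · subst h1; omega
  · subst h2; omega
  · omega

lemma single_add_single_add_single_le {m : σ →₀ ℕ} {p q r : σ} (hp : p ∈ m.support)
    (hq : q ∈ m.support) (hr : r ∈ m.support) (hpq : p ≠ q) (hpr : p ≠ r) (hqr : q ≠ r) :
    Finsupp.single p 1 + Finsupp.single q 1 + Finsupp.single r 1 ≤ m := by
  classical
  intro x
  have h := single_add_single_le hp hq hpq x
  rw [Finsupp.mem_support_iff] at hr
  rw [Finsupp.add_apply]
  by_cases h3 : r = x
  · subst h3
    simp only [Finsupp.add_apply, Finsupp.single_apply, if_neg hpr, if_neg hqr, if_true]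
    omega
  · rw [Finsupp.single_apply, if_neg h3]
    exact h

variable {L : Type*} [AddCommMonoid L] [LinearOrder L]
  (W : (σ →₀ ℕ) →+ L)

/-- The monomial is the least one of its degree with its sum of points. -/
def IsMin (m : σ →₀ ℕ) : Prop := ∀ l, latSum pt l = latSum pt m → W m ≤ W l

/-- All divisors of degree at most three are least for their degree and sum of points. -/
def IsLocallyMin (m : σ →₀ ℕ) : Prop := ∀ l ≤ m, l.degree ≤ 3 → IsMin pt W l

variable {pt W}

lemma IsMin.mono [IsOrderedCancelAddMonoid L] {m l : σ →₀ ℕ} (hm : IsMin pt W m)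
    (hl : l ≤ m) : IsMin pt W l := by
  intro l' h
  obtain ⟨c, rfl⟩ := exists_add_of_le hl
  have := hm (l' + c) (by rw [map_add, map_add, h])
  rw [map_add, map_add] at this
  exact le_of_add_le_add_right this

lemma IsMin.isLocallyMin [IsOrderedCancelAddMonoid L] {m : σ →₀ ℕ} (hm : IsMin pt W m) :
    IsLocallyMin pt W m :=
  fun _ hl _ => hm.mono hl

lemma IsLocallyMin.isMin_pair {m : σ →₀ ℕ} (hm : IsLocallyMin pt W m) {p q : σ}
    (hp : p ∈ m.support) (hq : q ∈ m.support) (hpq : p ≠ q) :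
    IsMin pt W (Finsupp.single p 1 + Finsupp.single q 1) :=
  hm _ (single_add_single_le hp hq hpq) (by simp)

lemma IsLocallyMin.isMin_triple {m : σ →₀ ℕ} (hm : IsLocallyMin pt W m) {p q r : σ}
    (hp : p ∈ m.support) (hq : q ∈ m.support) (hr : r ∈ m.support) (hpq : p ≠ q) (hpr : p ≠ r)
    (hqr : q ≠ r) : IsMin pt W (Finsupp.single p 1 + Finsupp.single q 1 + Finsupp.single r 1) :=
  hm _ (single_add_single_add_single_le hp hq hr hpq hpr hqr) (by simp)

lemma IsMin.not_even_sub (hinj : Function.Injective pt) (hc : LatticeConvex pt)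
    (hW : ∀ m l, sqWeight pt m < sqWeight pt l → W m < W l) {p q : σ} (hpq : p ≠ q)
    (hm : IsMin pt W (Finsupp.single p 1 + Finsupp.single q 1)) :
    ¬ (Even ((pt p).1 - (pt q).1) ∧ Even ((pt p).2 - (pt q).2)) := by
  rintro ⟨⟨a, ha⟩, ⟨b, hb⟩⟩
  obtain ⟨x, hx⟩ := hc p q q ((pt q).1 + a, (pt q).2 + b) 1 1 0 (by simp) (by simp) le_rfl
    (by simp) (by simp only; linarith) (by simp only; linarith)
  refine absurd (hm (Finsupp.single x 2) ?_) (not_le_of_gt (hW _ _ ?_))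
  · simp only [map_add, latSum_single, hx, Prod.mk_add_mk, Prod.mk.injEq]
    refine ⟨?_, ?_, trivial⟩ <;> push_cast <;> linarith
  · have := normSq_pos (hinj.ne hpq)
    simp only [map_add, sqWeight_single, hx]
    simp only [normSq, Prod.fst_sub, Prod.snd_sub] at *
    push_cast
    rw [ha, hb] at this
    have e1 : (pt p).1 = (pt q).1 + 2 * a := by linarith
    have e2 : (pt p).2 = (pt q).2 + 2 * b := by linarith
    rw [e1, e2]
    nlinarith

lemma IsMin.hdet_le_one (hc : LatticeConvex pt)
    (hW : ∀ m l, sqWeight pt m < sqWeight pt l → W m < W l) {p q r : σ}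
    (hm : IsMin pt W (Finsupp.single p 1 + Finsupp.single q 1 + Finsupp.single r 1)) :
    hdet 1 (pt p) (pt q) (pt r) ≤ 1 := by
  by_contra! hD
  have hD0 : 0 < hdet 1 (pt p) (pt q) (pt r) := by omega
  obtain ⟨t', t1, k1, t2, k2, t3, k3⟩ := exists_lattice_point_triangle _ _ _ hD
  obtain ⟨t, rfl⟩ := hc.exists_of_hdet_nonneg p q r t' hD0 t1 t2 t3
  set u := pt p + pt q + pt r - pt t with hu
  have e1 : hdet (2 : ℕ) u (pt q) (pt r) =
      hdet 1 (pt p) (pt q) (pt r) - hdet 1 (pt t) (pt q) (pt r) := by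
    simp only [hdet, hu, Prod.fst_sub, Prod.snd_sub, Prod.fst_add, Prod.snd_add]; push_cast; ring
  have e2 : hdet (2 : ℕ) u (pt r) (pt p) =
      hdet 1 (pt p) (pt q) (pt r) - hdet 1 (pt t) (pt r) (pt p) := by
    simp only [hdet, hu, Prod.fst_sub, Prod.snd_sub, Prod.fst_add, Prod.snd_add]; push_cast; ring
  have e3 : hdet (2 : ℕ) u (pt p) (pt q) =
      hdet 1 (pt p) (pt q) (pt r) - hdet 1 (pt t) (pt p) (pt q) := by
    simp only [hdet, hu, Prod.fst_sub, Prod.snd_sub, Prod.fst_add, Prod.snd_add]; push_cast; ring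
  obtain ⟨m, hsum, hle⟩ := hc.exists_latSum_eq u 2 p q r hD0 (by omega) (by omega) (by omega)
  have hlt := normSq_lt _ _ _ _ hD0 t1 t2 t3 k1 k2 k3
  rw [e1, e2, e3] at hle
  refine absurd (hm (m + Finsupp.single t 1) ?_) (not_le_of_gt (hW _ _ ?_))
  · simp only [map_add, latSum_single, hsum, Prod.mk_add_mk, Prod.mk.injEq, hu, Prod.fst_sub,
      Prod.snd_sub, Prod.fst_add, Prod.snd_add]
    refine ⟨?_, ?_, trivial⟩ <;> push_cast <;> ring
  · simp only [map_add, sqWeight_single, Nat.cast_one, one_mul]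
    refine lt_of_mul_lt_mul_left ?_ hD0.le
    linarith

lemma IsLocallyMin.hdet_eq_one_or (hinj : Function.Injective pt) (hc : LatticeConvex pt)
    (hW : ∀ m l, sqWeight pt m < sqWeight pt l → W m < W l) {m : σ →₀ ℕ}
    (hm : IsLocallyMin pt W m) {p q r : σ} (hp : p ∈ m.support) (hq : q ∈ m.support)
    (hr : r ∈ m.support) (hpq : p ≠ q) (hpr : p ≠ r) (hqr : q ≠ r) :
    hdet 1 (pt p) (pt q) (pt r) = 1 ∨ hdet 1 (pt p) (pt q) (pt r) = -1 := by
  have h1 := (hm.isMin_triple hp hq hr hpq hpr hqr).hdet_le_one hc hW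
  have h2 := (hm.isMin_triple hp hr hq hpr hpq hqr.symm).hdet_le_one hc hW
  have e : hdet 1 (pt p) (pt r) (pt q) = - hdet 1 (pt p) (pt q) (pt r) := by
    simp only [hdet]; ring
  have h3 : ¬ Even (hdet 1 (pt p) (pt q) (pt r)) := by
    have k1 := (hm.isMin_pair hp hq hpq).not_even_sub hinj hc hW hpq
    have k2 := (hm.isMin_pair hp hr hpr).not_even_sub hinj hc hW hpr
    have k3 := (hm.isMin_pair hq hr hqr).not_even_sub hinj hc hW hqr
    simp only [hdet, Int.even_add, Int.even_sub, Int.even_mul, Int.not_even_one] at *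
    generalize Even (pt p).1 = a at *
    generalize Even (pt p).2 = b at *
    generalize Even (pt q).1 = c at *
    generalize Even (pt q).2 = d at *
    generalize Even (pt r).1 = e at *
    generalize Even (pt r).2 = f at *
    clear hinj hc hW hm hp hq hr hpq hpr hqr h1 h2
    grind
  rw [Int.even_iff] at h3
  omega

lemma IsLocallyMin.card_support_le (hinj : Function.Injective pt) (hc : LatticeConvex pt)
    (hW : ∀ m l, sqWeight pt m < sqWeight pt l → W m < W l) (hWi : Function.Injective W)
    {m : σ →₀ ℕ} (hm : IsLocallyMin pt W m) : m.support.card ≤ 3 := by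
  classical
  by_contra! h
  obtain ⟨F, hF, hF4⟩ := Finset.exists_subset_card_eq (show 4 ≤ m.support.card from h)
  obtain ⟨p, q, r, t, hpq, hpr, hpt, hqr, hqt, hrt, rfl⟩ := Finset.card_eq_four.1 hF4
  have hp : p ∈ m.support := hF (by simp)
  have hq : q ∈ m.support := hF (by simp)
  have hr : r ∈ m.support := hF (by simp)
  have ht : t ∈ m.support := hF (by simp)
  have d1 := hm.hdet_eq_one_or hinj hc hW hq hr ht hqr hqt hrt
  have d2 := hm.hdet_eq_one_or hinj hc hW hp hr ht hpr hpt hrt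
  have d3 := hm.hdet_eq_one_or hinj hc hW hp hq ht hpq hpt hqt
  have d4 := hm.hdet_eq_one_or hinj hc hW hp hq hr hpq hpr hqr
  have e0 : hdet 1 (pt q) (pt r) (pt t) - hdet 1 (pt p) (pt r) (pt t) +
      hdet 1 (pt p) (pt q) (pt t) - hdet 1 (pt p) (pt q) (pt r) = 0 := by
    simp only [hdet]; ring
  have e1 : hdet 1 (pt q) (pt r) (pt t) * (pt p).1 - hdet 1 (pt p) (pt r) (pt t) * (pt q).1 +
      hdet 1 (pt p) (pt q) (pt t) * (pt r).1 - hdet 1 (pt p) (pt q) (pt r) * (pt t).1 = 0 := by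
    simp only [hdet]; ring
  have e2 : hdet 1 (pt q) (pt r) (pt t) * (pt p).2 - hdet 1 (pt p) (pt r) (pt t) * (pt q).2 +
      hdet 1 (pt p) (pt q) (pt t) * (pt r).2 - hdet 1 (pt p) (pt q) (pt r) * (pt t).2 = 0 := by
    simp only [hdet]; ring
  have key : ∀ {a b c d : σ}, a ∈ m.support → b ∈ m.support → c ∈ m.support → d ∈ m.support →
      a ≠ b → c ≠ d → a ≠ c → a ≠ d → (pt a).1 + (pt b).1 = (pt c).1 + (pt d).1 →
      (pt a).2 + (pt b).2 = (pt c).2 + (pt d).2 → False := by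
    intro a b c d ha hb hcm hd hab hcd hac had h1 h2
    have hs : latSum pt (Finsupp.single a 1 + Finsupp.single b 1) =
        latSum pt (Finsupp.single c 1 + Finsupp.single d 1) := by
      simp [h1, h2]
    have := hWi (le_antisymm (hm.isMin_pair ha hb hab _ hs.symm) (hm.isMin_pair hcm hd hcd _ hs))
    have := DFunLike.congr_fun this a
    simp [Finsupp.single_apply, hac.symm, had.symm] at this
  rcases d1 with d1 | d1 <;> rcases d2 with d2 | d2 <;> rcases d3 with d3 | d3 <;>
    rcases d4 with d4 | d4 <;> rw [d1, d2, d3, d4] at e0 e1 e2 <;> first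
      | omega
      | exact key hp hq hr ht hpq hrt hpr hpt (by linarith) (by linarith)
      | exact key hp hr hq ht hpr hqt hpq hpt (by linarith) (by linarith)
      | exact key hp ht hq hr hpt hqr hpq hpr (by linarith) (by linarith)

lemma even_sum_mul_iff {ι : Type*} (S : Finset ι) (a : ι → ℕ) (x : ι → ℤ) :
    Even (∑ i ∈ S, (a i : ℤ) * x i) ↔ Even (∑ i ∈ S with Odd (a i), x i) := by
  rw [← Int.even_sub, Finset.sum_filter, ← Finset.sum_sub_distrib]
  refine Finset.even_sum _ fun i _ => ?_
  split_ifs with h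
  · simp [Int.even_sub, Int.even_mul, h]
  · simp [Nat.not_odd_iff_even.1 h]

lemma latSum_eq (m : σ →₀ ℕ) : latSum pt m =
    (∑ p ∈ m.support, (m p : ℤ) * (pt p).1, ∑ p ∈ m.support, (m p : ℤ) * (pt p).2,
      ∑ p ∈ m.support, m p) := by
  simp [latSum, Finsupp.linearCombination_apply, Finsupp.sum, Prod.ext_iff, Prod.fst_sum,
    Prod.snd_sum]

lemma IsLocallyMin.exists_eq_two_nsmul (hinj : Function.Injective pt) (hc : LatticeConvex pt)
    (hW : ∀ m l, sqWeight pt m < sqWeight pt l → W m < W l) (hWi : Function.Injective W)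
    {m : σ →₀ ℕ} (hm : IsLocallyMin pt W m) {v : ℤ × ℤ × ℕ} (hv : latSum pt m = 2 • v) :
    ∃ n, m = 2 • n := by
  classical
  have hcard := hm.card_support_le hinj hc hW hWi
  rw [latSum_eq] at hv
  have e1 : Even (∑ p ∈ m.support, (m p : ℤ) * (pt p).1) := by
    have := congrArg Prod.fst hv
    simp only at this
    rw [this]
    simp
  have e2 : Even (∑ p ∈ m.support, (m p : ℤ) * (pt p).2) := by
    have := congrArg (fun x => x.2.1) hv
    simp only at this
    rw [this]
    simp
  have e3 : Even (∑ p ∈ m.support, (m p : ℤ) * 1) := by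
    have := congrArg (fun x => x.2.2) hv
    simp only at this
    simp only [mul_one]
    rw [← Nat.cast_sum, this]
    simp
  rw [even_sum_mul_iff] at e1 e2 e3
  have hO := Finset.card_filter_le m.support fun p => Odd (m p)
  have hmem : ∀ p ∈ m.support.filter fun p => Odd (m p), p ∈ m.support := fun p hp =>
    (Finset.mem_filter.1 hp).1
  have hempty : (m.support.filter fun p => Odd (m p)) = ∅ := by
    generalize hOdef : (m.support.filter fun p => Odd (m p)) = O at *
    have h4 : O.card ≤ 3 := hO.trans hcard
    simp only [Finset.sum_const, nsmul_eq_mul, mul_one, Int.even_coe_nat] at e3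
    interval_cases h : O.card
    · exact Finset.card_eq_zero.1 h
    · simp at e3
    · exfalso
      obtain ⟨p, q, hpq, rfl⟩ := Finset.card_eq_two.1 h
      rw [Finset.sum_pair hpq] at e1 e2
      refine (hm.isMin_pair (hmem p (by simp)) (hmem q (by simp)) hpq).not_even_sub hinj hc hW hpq
        ⟨?_, ?_⟩
      · rw [Int.even_sub]; rwa [Int.even_add] at e1
      · rw [Int.even_sub]; rwa [Int.even_add] at e2
    · simp [Nat.even_iff] at e3
  refine ⟨m.mapRange (· / 2) rfl, ?_⟩
  ext p
  have : Even (m p) := by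
    by_contra h
    rw [Nat.not_even_iff_odd] at h
    have hp : p ∈ m.support.filter fun p => Odd (m p) := by
      simp only [Finset.mem_filter, Finsupp.mem_support_iff]
      exact ⟨fun h0 => by simp [h0] at h, h⟩
    simp [hempty] at hp
  obtain ⟨k, hk⟩ := this
  simp only [Finsupp.smul_apply, Finsupp.mapRange_apply, smul_eq_mul]
  omega

lemma finite_latSum_eq [Finite σ] (v : ℤ × ℤ × ℕ) : {m | latSum pt m = v}.Finite := by
  refine (Finsupp.finite_of_degree_le v.2.2).subset fun m hm => ?_
  rw [Set.mem_ofPred_eq] at hm ⊢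
  rw [← latSum_snd_snd pt, hm]

lemma IsMin.nsmul_two [Finite σ] [IsOrderedCancelAddMonoid L] (hinj : Function.Injective pt)
    (hc : LatticeConvex pt) (hW : ∀ m l, sqWeight pt m < sqWeight pt l → W m < W l)
    (hWi : Function.Injective W) {m : σ →₀ ℕ} (hm : IsMin pt W m) : IsMin pt W (2 • m) := by
  obtain ⟨x, hx, hmin⟩ := Set.exists_min_image _ W (finite_latSum_eq (latSum pt (2 • m)))
    ⟨2 • m, rfl⟩
  rw [Set.mem_ofPred_eq] at hx
  have hxm : IsMin pt W x := fun l hl => hmin l (hl.trans hx)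
  obtain ⟨n, rfl⟩ := hxm.isLocallyMin.exists_eq_two_nsmul hinj hc hW hWi
    (hx.trans (map_nsmul _ _ _))
  have hn : latSum pt n = latSum pt m := by
    rw [map_nsmul, map_nsmul, two_nsmul, two_nsmul] at hx
    simp only [Prod.ext_iff, Prod.fst_add, Prod.snd_add] at hx ⊢
    omega
  intro l hl
  refine le_trans ?_ (hmin l hl)
  rw [map_nsmul, map_nsmul]
  exact nsmul_le_nsmul_right (hm n hn) 2

lemma IsLocallyMin.isMin [Finite σ] [IsOrderedCancelAddMonoid L] (hinj : Function.Injective pt)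
    (hc : LatticeConvex pt) (hW : ∀ m l, sqWeight pt m < sqWeight pt l → W m < W l)
    (hWi : Function.Injective W) {m : σ →₀ ℕ} (hm : IsLocallyMin pt W m) : IsMin pt W m := by
  set e : σ →₀ ℕ := m.mapRange (fun n => min n 1) (by simp) with he
  have hle : e ≤ m := fun p => by simp [he]
  have hdeg : e.degree ≤ 3 := by
    refine le_trans ?_ (hm.card_support_le hinj hc hW hWi)
    rw [Finsupp.degree_apply, Finset.card_eq_sum_ones]
    refine (Finset.sum_le_sum_of_subset (Finsupp.support_mono hle)).trans
      (Finset.sum_le_sum fun p _ => by simp [he])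
  have hpow : ∀ j : ℕ, IsMin pt W (2 ^ j • e) := by
    intro j
    induction j with
    | zero => simpa using hm e hle hdeg
    | succ j ih =>
      rw [pow_succ', mul_nsmul']
      exact ih.nsmul_two hinj hc hW hWi
  refine (hpow m.degree).mono fun p => ?_
  have h1 := Finsupp.le_degree p m
  have h2 := Nat.lt_two_pow_self (n := m.degree)
  simp only [Finsupp.smul_apply, he, Finsupp.mapRange_apply, smul_eq_mul]
  rcases Nat.eq_zero_or_pos (m p) with h | h
  · simp [h]
  · rw [min_eq_right h]; omega

/-- An additive congruence that identifies the monomials of degree at most three with the same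
sum of points identifies all monomials with the same degree and sum of points, provided the points
can be compared by an additive total order refining the squared norm. -/
lemma addCon_of_latSum_eq_of_order [Finite σ] [IsOrderedCancelAddMonoid L]
    (hinj : Function.Injective pt)
    (hc : LatticeConvex pt) (hW : ∀ m l, sqWeight pt m < sqWeight pt l → W m < W l)
    (hWi : Function.Injective W) (c : AddCon (σ →₀ ℕ))
    (h3 : ∀ m l : σ →₀ ℕ, m.degree ≤ 3 → latSum pt m = latSum pt l → c m l) {m l : σ →₀ ℕ}
    (h : latSum pt m = latSum pt l) : c m l := by
  have red : ∀ m, ∃ n, c m n ∧ latSum pt n = latSum pt m ∧ IsMin pt W n := by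
    intro m
    obtain ⟨n, ⟨hn, hcn⟩, hmin⟩ := Set.exists_min_image {n | latSum pt n = latSum pt m ∧ c m n} W
      ((finite_latSum_eq (latSum pt m)).subset fun n hn => hn.1) ⟨m, rfl, c.refl m⟩
    refine ⟨n, hcn, hn, IsLocallyMin.isMin hinj hc hW hWi fun x hx hdx y hy => ?_⟩
    obtain ⟨z, rfl⟩ := exists_add_of_le hx
    have := hmin (y + z) ⟨by rw [← hn, map_add, map_add, hy],
      c.trans hcn (c.add (h3 x y hdx hy.symm) (c.refl z))⟩
    rw [map_add, map_add] at this
    exact le_of_add_le_add_right this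
  obtain ⟨m', hm, hm1, hm2⟩ := red m
  obtain ⟨l', hl, hl1, hl2⟩ := red l
  have e : latSum pt m' = latSum pt l' := by rw [hm1, hl1, h]
  have : m' = l' := hWi (le_antisymm (hm2 _ e.symm) (hl2 _ e))
  subst this
  exact c.trans hm (c.symm hl)

lemma addCon_of_latSum_eq [Finite σ] (hinj : Function.Injective pt) (hc : LatticeConvex pt)
    (c : AddCon (σ →₀ ℕ))
    (h3 : ∀ m l : σ →₀ ℕ, m.degree ≤ 3 → latSum pt m = latSum pt l → c m l) {m l : σ →₀ ℕ}
    (h : latSum pt m = latSum pt l) : c m l := by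
  obtain ⟨n, ⟨e⟩⟩ := Finite.exists_equiv_fin σ
  let W : (σ →₀ ℕ) →+ ℤ ×ₗ Lex (Fin n →₀ ℕ) :=
    { toFun := fun m => toLex (sqWeight pt m, toLex (Finsupp.domCongr e m))
      map_zero' := by simp
      map_add' := fun a b => by simp only [map_add]; rfl }
  refine addCon_of_latSum_eq_of_order (W := W) hinj hc (fun a b hab => ?_) (fun a b hab => ?_) c
    h3 h
  · exact Prod.Lex.toLex_lt_toLex.2 (Or.inl hab)
  · have := congrArg (fun x => ofLex (ofLex x).2) hab
    exact (Finsupp.domCongr (M := ℕ) e).injective this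

end Combinatorics

section Geometry

lemma finite_latPt {Γ : Set (ℝ × ℝ)} (h : IsLatticePolygon Γ) : Finite (LatPt Γ) := by
  obtain ⟨S, rfl⟩ := h
  obtain ⟨R, hR⟩ := (isBounded_convexHull.2 (S.finite_toSet.image toR).isBounded).exists_norm_le
  refine ((Set.finite_Icc ((-⌈R⌉, -⌈R⌉) : ℤ × ℤ) (⌈R⌉, ⌈R⌉)).subset fun p hp => ?_).to_subtype
  have h1 := (hR _ hp).trans (Int.le_ceil R)
  simp only [toR, Prod.norm_def, Real.norm_eq_abs, sup_le_iff, abs_le] at h1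
  simp only [Set.mem_Icc, Prod.le_def]
  obtain ⟨⟨h1, h2⟩, h3, h4⟩ := h1
  exact ⟨⟨by exact_mod_cast h1, by exact_mod_cast h3⟩, by exact_mod_cast h2, by exact_mod_cast h4⟩

lemma latticeConvex_of_convex {Γ : Set (ℝ × ℝ)} (h : Convex ℝ Γ) :
    LatticeConvex (Subtype.val : LatPt Γ → ℤ × ℤ) := by
  intro p q r x a b c ha hb hc hs h1 h2
  have hsR : (0 : ℝ) < a + b + c := by exact_mod_cast hs
  have h1R : ((a : ℝ) + b + c) * x.1 = a * p.1.1 + b * q.1.1 + c * r.1.1 := by exact_mod_cast h1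
  have h2R : ((a : ℝ) + b + c) * x.2 = a * p.1.2 + b * q.1.2 + c * r.1.2 := by exact_mod_cast h2
  have haR : (0 : ℝ) ≤ a := by exact_mod_cast ha
  have hbR : (0 : ℝ) ≤ b := by exact_mod_cast hb
  have hcR : (0 : ℝ) ≤ c := by exact_mod_cast hc
  refine ⟨⟨x, ?_⟩, rfl⟩
  have key := h.sum_mem (t := Finset.univ)
    (w := ![(a : ℝ) / (a + b + c), b / (a + b + c), c / (a + b + c)])
    (z := ![toR p, toR q, toR r]) ?_ ?_ ?_
  · convert key
    simp only [Fin.sum_univ_three, toR, Prod.ext_iff]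
    simp
    field_simp
    exact ⟨by linarith, by linarith⟩
  · intro i _
    fin_cases i <;> simp <;> positivity
  · simp only [Fin.sum_univ_three]
    simp
    field_simp
  · intro i _
    fin_cases i <;> simp [p.2, q.2, r.2]

lemma collinear_of_hdet_eq_zero {T : Set (ℤ × ℤ)} {p q : ℤ × ℤ} (hp : p ∈ T) (hpq : p ≠ q)
    (h : ∀ r ∈ T, hdet 1 p q r = 0) : Collinear ℝ (toR '' T) := by
  rw [collinear_iff_of_mem (Set.mem_image_of_mem toR hp)]
  refine ⟨toR q - toR p, ?_⟩
  rintro _ ⟨r, hr, rfl⟩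
  have h0 := h r hr
  have hn := normSq_pos hpq
  simp only [normSq, Prod.fst_sub, Prod.snd_sub] at hn
  simp only [hdet] at h0
  have hnR : (0 : ℝ) < (p.1 - q.1) ^ 2 + (p.2 - q.2) ^ 2 := by exact_mod_cast hn
  have h0R : (p.1 : ℝ) * (q.2 - r.2) - p.2 * (q.1 - r.1) + 1 * (q.1 * r.2 - q.2 * r.1) = 0 := by
    exact_mod_cast h0
  refine ⟨((r.1 - p.1) * (q.1 - p.1) + (r.2 - p.2) * (q.2 - p.2)) /
    ((p.1 - q.1) ^ 2 + (p.2 - q.2) ^ 2), ?_⟩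
  simp only [toR, vadd_eq_add, Prod.ext_iff, Prod.fst_add, Prod.snd_add, Prod.smul_fst,
    Prod.smul_snd, Prod.fst_sub, Prod.snd_sub, smul_eq_mul]
  constructor
  · field_simp
    linear_combination (p.2 - q.2 : ℝ) * h0R
  · field_simp
    linear_combination -(p.1 - q.1 : ℝ) * h0R

lemma collinear_convexHull_iff {s : Set (ℝ × ℝ)} :
    Collinear ℝ (convexHull ℝ s) ↔ Collinear ℝ s := by
  rw [collinear_iff_rank_le_one, collinear_iff_rank_le_one, ← direction_affineSpan,
    affineSpan_convexHull, direction_affineSpan]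

/-- A point of the convex hull of a set of lattice points that are not collinear lies in a
nondegenerate triangle with vertices in the set. -/
lemma exists_triangle {S : Set (ℤ × ℤ)} (hS : ¬ Collinear ℝ (toR '' S)) {x : ℝ × ℝ}
    (hx : x ∈ convexHull ℝ (toR '' S)) :
    ∃ p ∈ S, ∃ q ∈ S, ∃ r ∈ S, hdet 1 p q r ≠ 0 ∧ ∃ a b c : ℝ, 0 ≤ a ∧ 0 ≤ b ∧ 0 ≤ c ∧
      a + b + c = 1 ∧ a • toR p + b • toR q + c • toR r = x := by
  have third : ∀ p ∈ S, ∀ q, p ≠ q → ∃ r ∈ S, hdet 1 p q r ≠ 0 := by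
    intro p hp q hpq
    by_contra! h
    exact hS (collinear_of_hdet_eq_zero hp hpq h)
  have second : ∀ p ∈ S, ∃ q ∈ S, p ≠ q := by
    intro p hp
    by_contra! h
    refine hS ((collinear_singleton ℝ (toR p)).subset ?_)
    rintro _ ⟨q, hq, rfl⟩
    rw [← h q hq]; rfl
  obtain ⟨ι, _, z, w, hz, hind, hw, hsum, hxz⟩ := eq_pos_convex_span_of_mem_convexHull hx
  have hcard : Fintype.card ι ≤ 3 := by
    simpa using hind.card_le_finrank_succ.trans
      (Nat.succ_le_succ (Submodule.finrank_le (vectorSpan ℝ (Set.range z))))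
  choose P hPS hP using fun i => hz ⟨i, rfl⟩
  have e := Fintype.equivFin ι
  rw [← e.symm.sum_comp] at hsum hxz
  generalize Fintype.card ι = n at *
  interval_cases n
  · simp at hsum
  · rw [Fin.sum_univ_one] at hsum hxz
    obtain ⟨q, hq, hpq⟩ := second _ (hPS (e.symm 0))
    obtain ⟨r, hr, h⟩ := third _ (hPS (e.symm 0)) q hpq
    refine ⟨_, hPS (e.symm 0), q, hq, r, hr, h, _, 0, 0, (hw (e.symm 0)).le, le_rfl, le_rfl,
      by simpa using hsum, ?_⟩
    simpa [hP] using hxz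
  · rw [Fin.sum_univ_two] at hsum hxz
    obtain ⟨r, hr, h⟩ := third _ (hPS (e.symm 0)) (P (e.symm 1)) fun h => by
      have := hind.injective (by rw [← hP, h, hP] : z (e.symm 0) = z (e.symm 1))
      simp at this
    refine ⟨_, hPS (e.symm 0), _, hPS (e.symm 1), r, hr, h, _, _, 0, (hw (e.symm 0)).le,
      (hw (e.symm 1)).le, le_rfl, by simpa using hsum, ?_⟩
    simpa [hP] using hxz
  · rw [Fin.sum_univ_three] at hsum hxz
    refine ⟨_, hPS (e.symm 0), _, hPS (e.symm 1), _, hPS (e.symm 2), fun h => ?_, _, _, _,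
      (hw (e.symm 0)).le, (hw (e.symm 1)).le, (hw (e.symm 2)).le, hsum, by simpa [hP] using hxz⟩
    have h3 := affineIndependent_iff_not_collinear.1 (hind.comp_embedding e.symm.toEmbedding)
    refine h3 ?_
    have hr : Set.range (z ∘ e.symm.toEmbedding) = toR '' Set.range (P ∘ e.symm) := by
      rw [← Set.range_comp]
      congr 1
      ext1 i
      exact (hP _).symm
    rw [hr]
    refine collinear_of_hdet_eq_zero (p := P (e.symm 0)) (q := P (e.symm 1)) ⟨0, rfl⟩
      (fun h => ?_) ?_
    · have := hind.injective (by rw [← hP, h, hP] : z (e.symm 0) = z (e.symm 1))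
      simp at this
    · rintro _ ⟨i, rfl⟩
      fin_cases i
      · simp [hdet]; ring
      · simp [hdet]; ring
      · exact h

/-- Lattice points of a dilated polygon are sums of lattice points of the polygon. -/
lemma image_latSum {Γ : Set (ℝ × ℝ)} (hpoly : IsLatticePolygon Γ) (hdim : ¬ Collinear ℝ Γ)
    {d : ℕ} (hd : d ≠ 0) :
    latSum (Subtype.val : LatPt Γ → ℤ × ℤ) '' {m | m.degree = d} =
      (fun s : ℤ × ℤ => (s.1, s.2, d)) '' latticePts ((d : ℝ) • Γ) := by
  obtain ⟨S, rfl⟩ := hpoly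
  rw [collinear_convexHull_iff] at hdim
  have hconv := convex_convexHull ℝ (toR '' (S : Set (ℤ × ℤ)))
  have hd0 : (d : ℝ) ≠ 0 := by exact_mod_cast hd
  ext v
  constructor
  · rintro ⟨m, rfl, rfl⟩
    refine ⟨((latSum Subtype.val m).1, (latSum Subtype.val m).2.1), ?_, ?_⟩
    · rw [latticePts, Set.mem_ofPred_eq, Set.mem_smul_set_iff_inv_smul_mem₀ hd0]
      have key := hconv.sum_mem (t := m.support) (w := fun p => (m.degree : ℝ)⁻¹ * m p)
        (z := fun p => toR p) (fun p _ => by positivity) ?_ fun p _ => p.2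
      · convert key
        rw [latSum_eq]
        simp only [toR, Prod.ext_iff, Prod.smul_fst, Prod.smul_snd, Prod.fst_sum, Prod.snd_sum,
          smul_eq_mul, mul_assoc, ← Finset.mul_sum]
        push_cast
        trivial
      · rw [← Finset.mul_sum, ← Nat.cast_sum, ← Finsupp.degree_apply, inv_mul_cancel₀ hd0]
    · rw [← latSum_snd_snd (Subtype.val : LatPt (convexHull ℝ (toR '' (S : Set (ℤ × ℤ)))) → ℤ × ℤ)]
  · rintro ⟨s, hs, rfl⟩
    rw [latticePts, Set.mem_ofPred_eq, Set.mem_smul_set_iff_inv_smul_mem₀ hd0] at hs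
    obtain ⟨p, hp, q, hq, r, hr, hD, a, b, c, ha, hb, hc, hsum, hx⟩ := exists_triangle hdim hs
    have main : ∀ p ∈ S, ∀ q ∈ S, ∀ r ∈ S, ∀ a b c : ℝ, 0 ≤ a → 0 ≤ b → 0 ≤ c → a + b + c = 1 →
        a • toR p + b • toR q + c • toR r = (d : ℝ)⁻¹ • toR s → 0 < hdet 1 p q r →
        (s.1, s.2, d) ∈ latSum (Subtype.val :
          LatPt (convexHull ℝ (toR '' (S : Set (ℤ × ℤ)))) → ℤ × ℤ) '' {m | m.degree = d} := by
      intro p hp q hq r hr a b c ha hb hc hsum hx hD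
      have hDR : (0 : ℝ) < hdet 1 p q r := by exact_mod_cast hD
      have hsub := fun t (ht : t ∈ S) => subset_convexHull ℝ _ (Set.mem_image_of_mem toR ht)
      simp only [toR, Prod.ext_iff, Prod.smul_fst, Prod.smul_snd, Prod.fst_add, Prod.snd_add,
        smul_eq_mul, inv_mul_eq_div, eq_div_iff hd0] at hx
      have hc' : c = 1 - a - b := by linarith
      have ea : 0 ≤ hdet d s q r := by
        have h : (hdet d s q r : ℝ) = d * a * hdet 1 p q r := by
          simp only [hdet]; push_cast; rw [← hx.1, ← hx.2, hc']; ring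
        have h0 : (0 : ℝ) ≤ hdet d s q r := by rw [h]; positivity
        exact_mod_cast h0
      have eb : 0 ≤ hdet d s r p := by
        have h : (hdet d s r p : ℝ) = d * b * hdet 1 p q r := by
          simp only [hdet]; push_cast; rw [← hx.1, ← hx.2, hc']; ring
        have h0 : (0 : ℝ) ≤ hdet d s r p := by rw [h]; positivity
        exact_mod_cast h0
      have ec : 0 ≤ hdet d s p q := by
        have h : (hdet d s p q : ℝ) = d * c * hdet 1 p q r := by
          simp only [hdet]; push_cast; rw [← hx.1, ← hx.2, hc']; ring
        have h0 : (0 : ℝ) ≤ hdet d s p q := by rw [h]; positivity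
        exact_mod_cast h0
      obtain ⟨m, hm, -⟩ := (latticeConvex_of_convex hconv).exists_latSum_eq s d ⟨p, hsub p hp⟩
        ⟨q, hsub q hq⟩ ⟨r, hsub r hr⟩ hD ea eb ec
      exact ⟨m, by rw [Set.mem_ofPred_eq, ← latSum_snd_snd Subtype.val, hm], hm⟩
    rcases hD.lt_or_gt with hD | hD
    · have e : hdet 1 p r q = - hdet 1 p q r := by simp only [hdet]; ring
      refine main p hp r hr q hq a c b ha hc hb (by linarith) ?_ (by omega)
      rw [← hx]; abel
    · exact main p hp q hq r hr a b c ha hb hc hsum hx hD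

end Geometry

section Algebra

variable {k : Type*} [Field k] {Γ : Set (ℝ × ℝ)}

lemma chi_monomial (m : LatPt Γ →₀ ℕ) (c : k) :
    chi k Γ (MvPolynomial.monomial m c) =
      AddMonoidAlgebra.single (latSum (Subtype.val : LatPt Γ → ℤ × ℤ) m) c := by
  have h : ∀ m : LatPt Γ →₀ ℕ, chi k Γ (MvPolynomial.monomial m 1) =
      AddMonoidAlgebra.single (latSum (Subtype.val : LatPt Γ → ℤ × ℤ) m) 1 := by
    intro m
    induction m using Finsupp.induction_linear with
    | zero => rw [map_zero, MvPolynomial.monomial_zero', MvPolynomial.C_1, map_one]; rfl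
    | add f g hf hg =>
      rw [← mul_one (1 : k), ← MvPolynomial.monomial_mul, map_mul, hf, hg,
        AddMonoidAlgebra.single_mul_single, map_add]
    | single p n =>
      rw [MvPolynomial.monomial_eq, latSum_single]
      simp [chi, AddMonoidAlgebra.single_pow]
  rw [← mul_one c, ← smul_eq_mul, ← MvPolynomial.smul_monomial, map_smul, h,
    AddMonoidAlgebra.smul_single]

/-- An ideal containing the difference of any two monomials with the same image contains the
toric ideal. -/
lemma toricIdeal_le {J : Ideal (MvPolynomial (LatPt Γ) k)}
    (h : ∀ m l, latSum (Subtype.val : LatPt Γ → ℤ × ℤ) m = latSum Subtype.val l →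
      MvPolynomial.monomial m 1 - MvPolynomial.monomial l 1 ∈ J) : toricIdeal k Γ ≤ J := by
  set g := Function.invFun (latSum (Subtype.val : LatPt Γ → ℤ × ℤ))
  have hg : ∀ m : LatPt Γ →₀ ℕ, latSum Subtype.val (g (latSum Subtype.val m)) =
      latSum Subtype.val m := fun m => Function.invFun_eq ⟨m, rfl⟩
  have key : ∀ f : MvPolynomial (LatPt Γ) k,
      f - AddMonoidAlgebra.mapDomain g (chi k Γ f) ∈ J := by
    intro f
    induction f using MvPolynomial.induction_on' with
    | monomial m a =>
      rw [chi_monomial, AddMonoidAlgebra.mapDomain_single]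
      have := J.mul_mem_left (MvPolynomial.C a) (h m _ (hg m).symm)
      rwa [mul_sub, MvPolynomial.C_mul_monomial, MvPolynomial.C_mul_monomial, mul_one] at this
    | add p q hp hq =>
      rw [map_add, AddMonoidAlgebra.mapDomain_add, add_sub_add_comm]
      exact J.add_mem hp hq
  intro f hf
  have := key f
  rwa [RingHom.mem_ker.1 hf, AddMonoidAlgebra.mapDomain_zero, sub_zero] at this

/-- The congruence of the monomials that agree modulo an ideal. -/
def monomialCon (J : Ideal (MvPolynomial (LatPt Γ) k)) : AddCon (LatPt Γ →₀ ℕ) where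
  r m l := MvPolynomial.monomial m 1 - MvPolynomial.monomial l 1 ∈ J
  iseqv :=
    { refl := fun m => by simp
      symm := fun {m l} h => by rw [← neg_sub]; exact J.neg_mem h
      trans := fun {a b c} h h' => by simpa using J.add_mem h h' }
  add' := fun {a b c d} h h' => by
    have := J.add_mem (J.mul_mem_right (MvPolynomial.monomial c 1) h)
      (J.mul_mem_left (MvPolynomial.monomial b 1) h')
    rw [sub_mul, mul_sub] at this
    simpa [MvPolynomial.monomial_mul] using this

theorem toricIdeal_eq_span [Finite (LatPt Γ)]
    (hc : LatticeConvex (Subtype.val : LatPt Γ → ℤ × ℤ)) :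
    toricIdeal k Γ = Ideal.span {f : MvPolynomial (LatPt Γ) k |
      f ∈ toricIdeal k Γ ∧ (f.IsHomogeneous 2 ∨ f.IsHomogeneous 3)} := by
  refine le_antisymm (toricIdeal_le fun m l h => ?_) (Ideal.span_le.2 fun f hf => hf.1)
  refine addCon_of_latSum_eq Subtype.val_injective hc (monomialCon _) (fun m l hm hml => ?_) h
  have hd : l.degree = m.degree := by
    rw [← latSum_snd_snd (Subtype.val : LatPt Γ → ℤ × ℤ), ← hml, latSum_snd_snd]
  by_cases h2 : 2 ≤ m.degree
  · refine Ideal.subset_span ⟨?_, ?_⟩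
    · rw [toricIdeal, RingHom.mem_ker, map_sub, chi_monomial, chi_monomial, hml, sub_self]
    · have : m.degree = 2 ∨ m.degree = 3 := by omega
      exact this.imp
        (fun e => (MvPolynomial.isHomogeneous_monomial 1 e).sub
          (MvPolynomial.isHomogeneous_monomial 1 (hd.trans e)))
        (fun e => (MvPolynomial.isHomogeneous_monomial 1 e).sub
          (MvPolynomial.isHomogeneous_monomial 1 (hd.trans e)))
  · suffices m = l by rw [this]; exact (monomialCon _).refl l
    rcases (show m.degree = 0 ∨ m.degree = 1 by omega) with h0 | h1
    · rw [(Finsupp.degree_eq_zero_iff m).1 h0, (Finsupp.degree_eq_zero_iff l).1 (hd.trans h0)]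
    · obtain ⟨p, rfl⟩ := (Finsupp.sum_eq_one_iff m).1 h1
      obtain ⟨q, rfl⟩ := (Finsupp.sum_eq_one_iff l).1 (hd.trans h1)
      simp only [latSum_single, Nat.cast_one, one_mul, Prod.mk.injEq, and_true] at hml
      rw [Subtype.ext (Prod.ext hml.1 hml.2)]

lemma finrank_supported {M : Type*} (T : Set M) [Finite T] :
    Module.finrank k (AddMonoidAlgebra.supported k k T) = T.ncard := by
  have := Fintype.ofFinite T
  rw [(AddMonoidAlgebra.supportedEquivFinsupp T).finrank_eq, Module.finrank_finsupp_self,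
    ← Nat.card_coe_set_eq, Nat.card_eq_fintype_card]

lemma ncard_degree_eq {σ : Type*} [Finite σ] (d : ℕ) :
    {m : σ →₀ ℕ | m.degree = d}.ncard = (Nat.card σ + d - 1).choose d := by
  classical
  have := Fintype.ofFinite σ
  rw [Nat.card_eq_fintype_card, ← Finset.card_univ, ← Finset.card_finsuppAntidiag_nat_eq_choose,
    ← Set.ncard_coe_finset]
  congr 1
  ext m
  simp [Finset.mem_finsuppAntidiag, Finsupp.degree_eq_sum]

lemma finrank_toricIdealDeg [Finite (LatPt Γ)] (d : ℕ) :
    Module.finrank k (toricIdealDeg k Γ d) +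
      (latSum (Subtype.val : LatPt Γ → ℤ × ℤ) '' {m | m.degree = d}).ncard =
      (Nat.card (LatPt Γ) + d - 1).choose d := by
  have hfin : {m : LatPt Γ →₀ ℕ | m.degree = d}.Finite :=
    (Finsupp.finite_of_degree_le d).subset fun m hm => le_of_eq hm
  have := hfin.to_subtype
  have := (hfin.image (latSum (Subtype.val : LatPt Γ → ℤ × ℤ))).to_subtype
  set H := MvPolynomial.homogeneousSubmodule (LatPt Γ) k d with hH
  rw [MvPolynomial.homogeneousSubmodule_eq_finsupp_supported] at hH
  have : Module.Finite k H := by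
    rw [hH]
    exact Module.Finite.equiv (AddMonoidAlgebra.supportedEquivFinsupp _).symm
  have hmap : H.map (chi k Γ).toLinearMap = AddMonoidAlgebra.supported k k
      (latSum (Subtype.val : LatPt Γ → ℤ × ℤ) '' {m | m.degree = d}) := by
    rw [hH, AddMonoidAlgebra.supported_eq_span_single, AddMonoidAlgebra.supported_eq_span_single,
      Submodule.map_span, Set.image_image, Set.image_image]
    congr 1
    exact Set.image_congr fun m _ => chi_monomial m 1
  have hker : toricIdealDeg k Γ d =
      (LinearMap.ker ((chi k Γ).toLinearMap.domRestrict H)).map H.subtype := by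
    ext f
    rw [toricIdealDeg, LinearMap.ker_domRestrict, Submodule.map_comap_subtype, inf_comm]
    rfl
  have := LinearMap.finrank_range_add_finrank_ker ((chi k Γ).toLinearMap.domRestrict H)
  rw [LinearMap.range_domRestrict, hmap, finrank_supported] at this
  rw [hker, Submodule.finrank_map_subtype_eq, add_comm, this, hH, finrank_supported,
    ncard_degree_eq]

end Algebra

end LatticeRelations

theorem stmt1 (k : Type*) [Field k] [IsAlgClosed k] (Γ : Set (ℝ × ℝ))
    (hpoly : IsLatticePolygon Γ) (hdim : ¬ Collinear ℝ Γ) :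
    toricIdeal k Γ
      = Ideal.span {f : MvPolynomial (LatPt Γ) k |
          f ∈ toricIdeal k Γ ∧ (f.IsHomogeneous 2 ∨ f.IsHomogeneous 3)} ∧
    (Module.finrank k (toricIdealDeg k Γ 2) : ℤ)
      = (((latticePts Γ).ncard + 1).choose 2 : ℤ)
        - ((latticePts ((2 : ℝ) • Γ)).ncard : ℤ) := by
  have := LatticeRelations.finite_latPt hpoly
  refine ⟨LatticeRelations.toricIdeal_eq_span (LatticeRelations.latticeConvex_of_convex ?_), ?_⟩
  · obtain ⟨S, rfl⟩ := hpoly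
    exact convex_convexHull ℝ _
  · have h := LatticeRelations.finrank_toricIdealDeg (k := k) (Γ := Γ) 2
    have hinj : Function.Injective fun s : ℤ × ℤ => (s.1, s.2, 2) := fun a b hab => by
      simp only [Prod.mk.injEq, and_true] at hab
      exact Prod.ext hab.1 hab.2
    rw [LatticeRelations.image_latSum hpoly hdim two_ne_zero, Set.ncard_image_of_injective _ hinj,
      Nat.add_sub_assoc one_le_two] at h
    rw [eq_sub_iff_add_eq]
    exact_mod_cast h
end
end
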